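/- For all r, s ≥ 3, the general position number of the torus C_r □ C_s (Cartesian product of two cycles) is at most 9. -/

import Mathlib

/-- Cyclic distance on ZMod n. -/
def cycDist {n : ℕ} (a b : ZMod n) : ℕ := min (a - b).val (b - a).val

/-- Graph distance in the torus C_r □ C_s. -/
def torusDist {r s : ℕ} (p q : ZMod r × ZMod s) : ℕ :=
  cycDist p.1 q.1 + cycDist p.2 q.2

def IsGenPosDist {V : Type*} (d : V → V → ℕ) (S : Set V) : Prop :=
  ∀ u ∈ S, ∀ v ∈ S, ∀ w ∈ S, u ≠ v → v ≠ w → u ≠ w →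
    d u w ≠ d u v + d v w

theorem cycDist_comm' {n : ℕ} (a b : ZMod n) : cycDist a b = cycDist b a := by
  unfold cycDist; exact min_comm _ _

theorem cycDist_same_side {n : ℕ} [NeZero n] (x y w : ZMod n)
    (h : ((x - w).val * 2 ≤ n ↔ (y - w).val * 2 ≤ n)) (hle : cycDist x w ≤ cycDist y w) :
    cycDist x y + cycDist x w = cycDist y w := by
  have key : ∀ u v : ZMod n, (u.val * 2 ≤ n ↔ v.val * 2 ≤ n) →
      min u.val (-u).val ≤ min v.val (-v).val →
      min (u - v).val (v - u).val + min u.val (-u).val = min v.val (-v).val := by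
    intro u v h hle
    have hu := ZMod.val_lt u
    have hv := ZMod.val_lt v
    have aux : ∀ u v : ZMod n, v.val ≤ u.val →
        (u - v).val = u.val - v.val ∧
        (v - u).val = if u.val = v.val then 0 else n - (u.val - v.val) := by
      intro u v hvu
      have h1 := ZMod.val_sub hvu
      refine ⟨h1, ?_⟩
      rw [← neg_sub u v, ZMod.neg_val, h1]
      have : u - v = 0 ↔ u.val = v.val := by
        rw [sub_eq_zero]; exact (ZMod.val_injective n).eq_iff.symm
      simp only [this]
    have a0 := (aux u 0 (by simp)).2
    have b0 := (aux v 0 (by simp)).2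
    simp only [zero_sub, ZMod.val_zero, Nat.sub_zero] at a0 b0
    rcases le_total v.val u.val with hc | hc
    · obtain ⟨h1, h2⟩ := aux u v hc
      split_ifs at * <;> omega
    · obtain ⟨h1, h2⟩ := aux v u hc
      split_ifs at * <;> omega
  have := key (x - w) (y - w) h (by simpa [cycDist] using hle)
  simpa [cycDist] using this

/-- gp(C_r □ C_s) ≤ 9. -/
theorem stmt_15 {r s : ℕ} (hr : 3 ≤ r) (hs : 3 ≤ s)
    (S : Finset (ZMod r × ZMod s))
    (hS : IsGenPosDist torusDist (S : Set (ZMod r × ZMod s))) :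
    S.card ≤ 9 := by
  classical
  haveI : NeZero r := ⟨by omega⟩
  haveI : NeZero s := ⟨by omega⟩
  by_contra hcard
  have hne : S.Nonempty := Finset.card_pos.mp (by omega)
  obtain ⟨w, hw⟩ := hne
  let f : ZMod r × ZMod s → Bool × Bool := fun x =>
    (decide ((x.1 - w.1).val * 2 ≤ r), decide ((x.2 - w.2).val * 2 ≤ s))
  have hE : (S.erase w).card = S.card - 1 := Finset.card_erase_of_mem hw
  obtain ⟨q, -, hq⟩ := Finset.exists_lt_card_fiber_of_mul_lt_card_of_maps_to
    (s := S.erase w) (t := Finset.univ) (f := f) (n := 2) (fun _ _ => Finset.mem_univ _)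
    (by rw [hE]; simp; omega)
  obtain ⟨x, y, z, hx, hy, hz, hxy, hxz, hyz⟩ := Finset.two_lt_card_iff.mp hq
  simp only [Finset.mem_filter, Finset.mem_erase] at hx hy hz
  have side : ∀ x y, f x = q → f y = q →
      ((x.1 - w.1).val * 2 ≤ r ↔ (y.1 - w.1).val * 2 ≤ r) ∧
      ((x.2 - w.2).val * 2 ≤ s ↔ (y.2 - w.2).val * 2 ≤ s) := by
    intro x y h1 h2
    have h := h1.trans h2.symm
    simpa [f] using h
  have pair : ∀ x y, (x ≠ w ∧ x ∈ S) ∧ f x = q → (y ≠ w ∧ y ∈ S) ∧ f y = q → x ≠ y →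
      cycDist x.1 w.1 ≤ cycDist y.1 w.1 → cycDist y.2 w.2 < cycDist x.2 w.2 := by
    intro x y hx hy hxy h1
    by_contra h2
    obtain ⟨s1, s2⟩ := side x y hx.2 hy.2
    have e1 := cycDist_same_side _ _ _ s1 h1
    have e2 := cycDist_same_side _ _ _ s2 (not_lt.mp h2)
    apply hS y hy.1.2 x hx.1.2 w hw hxy.symm hx.1.1 hy.1.1
    unfold torusDist
    rw [cycDist_comm' y.1 x.1, cycDist_comm' y.2 x.2]
    omega
  have triple : ∀ x y z, (x ≠ w ∧ x ∈ S) ∧ f x = q → (y ≠ w ∧ y ∈ S) ∧ f y = q →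
      (z ≠ w ∧ z ∈ S) ∧ f z = q → x ≠ y → y ≠ z → x ≠ z →
      cycDist x.1 w.1 ≤ cycDist y.1 w.1 → cycDist y.1 w.1 ≤ cycDist z.1 w.1 → False := by
    intro x y z hx hy hz hxy hyz hxz h1 h2
    have p1 := pair x y hx hy hxy h1
    have p2 := pair y z hy hz hyz h2
    have a1 := cycDist_same_side _ _ _ (side x y hx.2 hy.2).1 h1
    have a2 := cycDist_same_side _ _ _ (side y z hy.2 hz.2).1 h2
    have a3 := cycDist_same_side _ _ _ (side x z hx.2 hz.2).1 (h1.trans h2)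
    have b1 := cycDist_same_side _ _ _ (side y x hy.2 hx.2).2 p1.le
    have b2 := cycDist_same_side _ _ _ (side z y hz.2 hy.2).2 p2.le
    have b3 := cycDist_same_side _ _ _ (side z x hz.2 hx.2).2 (p2.trans p1).le
    apply hS x hx.1.2 y hy.1.2 z hz.1.2 hxy hyz hxz
    unfold torusDist
    rw [cycDist_comm' x.2 z.2, cycDist_comm' x.2 y.2, cycDist_comm' y.2 z.2]
    omega
  rcases le_total (cycDist x.1 w.1) (cycDist y.1 w.1) with h1 | h1 <;>
  rcases le_total (cycDist y.1 w.1) (cycDist z.1 w.1) with h2 | h2 <;>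
  rcases le_total (cycDist x.1 w.1) (cycDist z.1 w.1) with h3 | h3
  · exact triple x y z hx hy hz hxy hyz hxz h1 h2
  · exact triple x y z hx hy hz hxy hyz hxz h1 h2
  · exact triple x z y hx hz hy hxz hyz.symm hxy h3 h2
  · exact triple z x y hz hx hy hxz.symm hxy hyz.symm h3 h1
  · exact triple y x z hy hx hz hxy.symm hxz hyz h1 h3
  · exact triple y z x hy hz hx hyz hxz.symm hxy.symm h2 h3
  · exact triple z y x hz hy hx hyz.symm hxy.symm hxz.symm h2 h1
  · exact triple z y x hz hy hx hyz.symm hxy.symm hxz.symm h2 h1
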